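/- arXiv:2002.00779 — 2 statements merged into one kernel-verified Lean document; each statement's English description precedes it below -/
import Mathlib

section
/- For random variables X and Y taking values in finite alphabets, the map γ ↦ C_γ(X;Y) is a convex function of γ on [0,∞), and it is continuous on [0,∞). -/
open scoped BigOperators
open Classical

noncomputable section

/-- `p` is a probability mass function on the finite alphabet `α`. -/
def IsPMF {α : Type*} [Fintype α] (p : α → ℝ) : Prop :=
  (∀ a, 0 ≤ p a) ∧ ∑ a, p a = 1

/-- Pushforward of a pmf under a map (distribution of `f(X)` when `X ~ p`). -/
noncomputable def pmfMap {α β : Type*} [Fintype α] (f : α → β) (p : α → ℝ) : β → ℝ :=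
  fun b => ∑ a, if f a = b then p a else 0

/-- Shannon entropy (in nats) of a pmf on a finite alphabet. -/
noncomputable def Hent {α : Type*} [Fintype α] (p : α → ℝ) : ℝ :=
  ∑ a, Real.negMulLog (p a)

/-- Mutual information `I(X;Y)` of a joint pmf `p` of the pair `(X,Y)`. -/
noncomputable def mi {α β : Type*} [Fintype α] [Fintype β] (p : α × β → ℝ) : ℝ :=
  Hent (pmfMap Prod.fst p) + Hent (pmfMap Prod.snd p) - Hent p

/-- Mutual information `I(X,Y;W)` of a joint pmf `q` of the triple `((X,Y),W)`. -/
noncomputable def miW {α β W : Type*} [Fintype α] [Fintype β] [Fintype W]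
    (q : (α × β) × W → ℝ) : ℝ :=
  Hent (pmfMap Prod.fst q) + Hent (pmfMap Prod.snd q) - Hent q

/-- Conditional mutual information `I(X;Y|W)` of a joint pmf `q` of `((X,Y),W)`,
written as `H(X,W) + H(Y,W) - H(W) - H(X,Y,W)`. -/
noncomputable def cmi {α β W : Type*} [Fintype α] [Fintype β] [Fintype W]
    (q : (α × β) × W → ℝ) : ℝ :=
  Hent (pmfMap (fun x => (x.1.1, x.2)) q) + Hent (pmfMap (fun x => (x.1.2, x.2)) q)
    - Hent (pmfMap Prod.snd q) - Hent q

/-- The set of values `I(X,Y;W)` over all finite-alphabet `W` jointly distributed with `(X,Y)`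
(i.e. over all conditional distributions `p(w|x,y)`) such that `I(X;Y|W) ≤ γ`. -/
def relaxedSet {α β : Type*} [Fintype α] [Fintype β] (p : α × β → ℝ) (γ : ℝ) : Set ℝ :=
  { c | ∃ (m : ℕ) (q : (α × β) × Fin m → ℝ), IsPMF q ∧
      (pmfMap Prod.fst q = p) ∧ cmi q ≤ γ ∧ c = miW q }

/-- Relaxed Wyner's common information `C_γ(X;Y)` of a joint pmf `p` of `(X,Y)`. -/
noncomputable def Cgamma {α β : Type*} [Fintype α] [Fintype β] (p : α × β → ℝ) (γ : ℝ) : ℝ :=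
  sInf (relaxedSet p γ)

/-- Wyner's common information `C(X;Y)`: infimum of `I(X,Y;W)` over all finite-alphabet `W`
rendering `X` and `Y` conditionally independent, i.e. `I(X;Y|W) = 0`. -/
noncomputable def WynerCI {α β : Type*} [Fintype α] [Fintype β] (p : α × β → ℝ) : ℝ :=
  sInf { c | ∃ (m : ℕ) (q : (α × β) × Fin m → ℝ), IsPMF q ∧
      (pmfMap Prod.fst q = p) ∧ cmi q = 0 ∧ c = miW q }

end

/-- In a finite-dimensional space the convex hull of a compact set is compact. -/
theorem isCompact_convexHull_of_finiteDimensional {E : Type*} [NormedAddCommGroup E]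
    [NormedSpace ℝ E] [FiniteDimensional ℝ E] {s : Set E} (hs : IsCompact s) :
    IsCompact (convexHull ℝ s) := by
  rcases s.eq_empty_or_nonempty with rfl | ⟨x₀, hx₀⟩
  · simp
  let n := Module.finrank ℝ E + 1
  have hc : IsCompact ((fun y : (Fin n → ℝ) × (Fin n → E) => ∑ j, y.1 j • y.2 j) ''
      (stdSimplex ℝ (Fin n) ×ˢ Set.univ.pi fun _ => s)) :=
    ((isCompact_stdSimplex ℝ _).prod (isCompact_univ_pi fun _ => hs)).image (by fun_prop)
  convert hc using 1
  refine Set.Subset.antisymm (fun x hx => ?_) ?_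
  · obtain ⟨ι, hι, z, w, hz, hind, hw, hw1, rfl⟩ := eq_pos_convex_span_of_mem_convexHull hx
    have hcard : Fintype.card ι ≤ Fintype.card (Fin n) := by
      simpa [n] using hind.card_le_finrank_succ.trans
        (Nat.add_le_add_right (Submodule.finrank_le _) 1)
    obtain ⟨e⟩ := Function.Embedding.nonempty_of_card_le hcard
    have hout : ∀ j ∉ Set.range e, Function.extend e w 0 j = 0 := fun j hj => by
      rw [Function.extend_apply' _ _ _ (by simpa using hj)]; rfl
    refine ⟨(Function.extend e w 0, Function.extend e z fun _ => x₀),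
      ⟨⟨fun j => ?_, ?_⟩, fun j _ => ?_⟩, ?_⟩
    · by_cases hj : j ∈ Set.range e
      · obtain ⟨i, rfl⟩ := hj
        simpa [e.injective.extend_apply] using (hw i).le
      · exact (hout j hj).ge
    · rw [← hw1]
      exact (Fintype.sum_of_injective e e.injective _ _ hout
        fun i => by simp [e.injective.extend_apply]).symm
    · by_cases hj : j ∈ Set.range e
      · obtain ⟨i, rfl⟩ := hj
        simpa [e.injective.extend_apply] using hz ⟨i, rfl⟩
      · simpa [Function.extend_apply' _ _ _ (show ¬∃ i, e i = j by simpa using hj)] using hx₀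
    · exact (Fintype.sum_of_injective e e.injective _ _ (fun j hj => by simp [hout j hj])
        fun i => by simp [e.injective.extend_apply]).symm
  · rintro _ ⟨⟨w, z⟩, ⟨⟨hw, hw1⟩, hz⟩, rfl⟩
    exact mem_convexHull_of_exists_fintype w z hw hw1 (fun i => hz i trivial) rfl

/-- The lower boundary `γ ↦ min {t | (t, i) ∈ T, i ≤ γ}` of a compact convex planar set meeting
the half-plane `i ≤ 0` is convex and continuous on `[0, ∞)`. -/
theorem convexOn_continuousOn_sInf_of_isCompact {T : Set (ℝ × ℝ)} (hT : IsCompact T)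
    (hconv : Convex ℝ T) (hne : ∃ z ∈ T, z.2 ≤ 0) :
    ConvexOn ℝ (Set.Ici 0) (fun γ => sInf {t | ∃ z ∈ T, z.2 ≤ γ ∧ t = z.1}) ∧
      ContinuousOn (fun γ => sInf {t | ∃ z ∈ T, z.2 ≤ γ ∧ t = z.1}) (Set.Ici 0) := by
  set f : ℝ → ℝ := fun γ => sInf {t | ∃ z ∈ T, z.2 ≤ γ ∧ t = z.1} with hf
  have himage (γ : ℝ) : {t | ∃ z ∈ T, z.2 ≤ γ ∧ t = z.1} = Prod.fst '' (T ∩ {z | z.2 ≤ γ}) := by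
    ext t
    constructor
    · rintro ⟨z, hz, hzγ, rfl⟩
      exact ⟨z, ⟨hz, hzγ⟩, rfl⟩
    · rintro ⟨z, ⟨hz, hzγ⟩, rfl⟩
      exact ⟨z, hz, hzγ, rfl⟩
  have hcomp (γ : ℝ) : IsCompact {t | ∃ z ∈ T, z.2 ≤ γ ∧ t = z.1} := by
    rw [himage]
    exact (hT.inter_right (isClosed_le continuous_snd continuous_const)).image continuous_fst
  have hmin : ∀ γ, 0 ≤ γ → ∃ z ∈ T, z.2 ≤ γ ∧ f γ = z.1 := fun γ hγ => by
    obtain ⟨z, hz, hz0⟩ := hne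
    exact (hcomp γ).sInf_mem ⟨z.1, z, hz, hz0.trans hγ, rfl⟩
  have hle {γ : ℝ} {z : ℝ × ℝ} (hz : z ∈ T) (hzγ : z.2 ≤ γ) : f γ ≤ z.1 :=
    csInf_le (hcomp γ).bddBelow ⟨z, hz, hzγ, rfl⟩
  have hcvx : ConvexOn ℝ (Set.Ici 0) f := by
    refine ⟨convex_Ici 0, fun x hx y hy a b ha hb hab => ?_⟩
    obtain ⟨z, hz, hzx, hfx⟩ := hmin x hx
    obtain ⟨z', hz', hzy, hfy⟩ := hmin y hy
    rw [hfx, hfy]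
    exact hle (hconv hz hz' ha hb hab) (by simp only [Prod.snd_add, Prod.smul_snd]; gcongr)
  refine ⟨hcvx, fun γ hγ => ?_⟩
  rcases (show (0 : ℝ) ≤ γ from hγ).eq_or_lt with rfl | hpos
  · refine tendsto_order.2 ⟨fun a ha => ?_, fun a ha => ?_⟩
    · rcases (T ∩ {z | z.1 ≤ a}).eq_empty_or_nonempty with hemp | hnonempty
      · filter_upwards [self_mem_nhdsWithin] with γ hγ
        obtain ⟨z, hz, -, hfz⟩ := hmin γ hγ
        rw [hfz]
        by_contra! hza
        exact (hemp ▸ (⟨hz, hza⟩ : z ∈ T ∩ {z | z.1 ≤ a}) : z ∈ (∅ : Set (ℝ × ℝ)))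
      · obtain ⟨z, ⟨hz, hza⟩, hzmin⟩ :=
          (hT.inter_right (isClosed_le continuous_fst continuous_const)).exists_isMinOn hnonempty
            continuous_snd.continuousOn
        have hz2 : 0 < z.2 := by
          by_contra! h
          exact absurd (ha.trans_le (hle hz h)) (not_lt.2 hza)
        filter_upwards [self_mem_nhdsWithin, mem_nhdsWithin_of_mem_nhds (Iio_mem_nhds hz2)]
          with γ hγ hγz
        obtain ⟨z', hz', hzγ, hfz⟩ := hmin γ hγ
        rw [hfz]
        by_contra! hza'
        exact absurd ((hzmin ⟨hz', hza'⟩ : z.2 ≤ z'.2).trans hzγ) (not_le.2 hγz)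
    · filter_upwards [self_mem_nhdsWithin] with γ hγ
      obtain ⟨z, hz, hz0, hfz⟩ := hmin 0 le_rfl
      exact (hle hz (hz0.trans hγ)).trans_lt (hfz ▸ ha)
  · have hint : γ ∈ interior (Set.Ici (0 : ℝ)) := by simpa using hpos
    exact ((hcvx.continuousOn_interior γ hint).continuousAt
      (isOpen_interior.mem_nhds hint)).continuousWithinAt

theorem pmfMap_prodMap_id_mixture {ι κ δ : Type*} [Fintype ι] [Fintype κ] (f : κ → δ) (c : ι → ℝ)
    (v : ι → κ → ℝ) :
    pmfMap (fun x : κ × ι => (f x.1, x.2)) (fun x => c x.2 * v x.2 x.1) =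
      fun z => c z.2 * pmfMap f (v z.2) z.1 := by
  funext ⟨d, i⟩
  simp [pmfMap, Fintype.sum_prod_type, ite_and, Finset.mul_sum]

theorem pmfMap_snd_mixture {ι κ : Type*} [Fintype ι] [Fintype κ] (c : ι → ℝ) (v : ι → κ → ℝ)
    (hv : ∀ i, ∑ a, v i a = 1) :
    pmfMap Prod.snd (fun x : κ × ι => c x.2 * v x.2 x.1) = c := by
  funext i
  simp [pmfMap, Fintype.sum_prod_type, ← Finset.mul_sum, hv]

theorem pmfMap_fst_mixture {ι κ : Type*} [Fintype ι] [Fintype κ] (c : ι → ℝ) (v : ι → κ → ℝ) :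
    pmfMap Prod.fst (fun x : κ × ι => c x.2 * v x.2 x.1) = ∑ i, c i • v i := by
  funext a
  simp [pmfMap, Fintype.sum_prod_type_right]

theorem sum_pmfMap {κ δ : Type*} [Fintype κ] [Fintype δ] (f : κ → δ) (p : κ → ℝ) :
    ∑ d, pmfMap f p d = ∑ a, p a := by
  simp only [pmfMap]
  rw [Finset.sum_comm]
  simp

/-- Chain rule for the entropy of a mixture. -/
theorem Hent_mixture {ι κ : Type*} [Fintype ι] [Fintype κ] (c : ι → ℝ) (v : ι → κ → ℝ)
    (hv : ∀ i, ∑ a, v i a = 1) :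
    Hent (fun x : κ × ι => c x.2 * v x.2 x.1) = Hent c + ∑ i, c i * Hent (v i) := by
  simp only [Hent, Fintype.sum_prod_type_right, Real.negMulLog_mul, Finset.sum_add_distrib,
    ← Finset.sum_mul, ← Finset.mul_sum, hv, one_mul]

theorem miW_mixture {ι α β : Type*} [Fintype ι] [Fintype α] [Fintype β] (c : ι → ℝ)
    (v : ι → α × β → ℝ) (hv : ∀ i, ∑ a, v i a = 1) :
    miW (fun x : (α × β) × ι => c x.2 * v x.2 x.1) =
      Hent (∑ i, c i • v i) - ∑ i, c i * Hent (v i) := by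
  rw [miW, pmfMap_fst_mixture, pmfMap_snd_mixture c v hv, Hent_mixture c v hv]
  ring

theorem cmi_mixture {ι α β : Type*} [Fintype ι] [Fintype α] [Fintype β] (c : ι → ℝ)
    (v : ι → α × β → ℝ) (hv : ∀ i, ∑ a, v i a = 1) :
    cmi (fun x : (α × β) × ι => c x.2 * v x.2 x.1) = ∑ i, c i * mi (v i) := by
  rw [cmi, pmfMap_prodMap_id_mixture Prod.fst, pmfMap_prodMap_id_mixture Prod.snd,
    pmfMap_snd_mixture c v hv, Hent_mixture c v hv,
    Hent_mixture c (fun i => pmfMap Prod.fst (v i)) (by simp [sum_pmfMap, hv]),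
    Hent_mixture c (fun i => pmfMap Prod.snd (v i)) (by simp [sum_pmfMap, hv])]
  simp only [mi, mul_sub, mul_add, Finset.sum_sub_distrib, Finset.sum_add_distrib]
  ring

/-- Every joint pmf disintegrates as a mixture of conditional pmfs. -/
theorem exists_eq_mixture {ι κ : Type*} [Fintype ι] [Fintype κ] {p : κ → ℝ} (hp : IsPMF p)
    {q : κ × ι → ℝ} (hq : IsPMF q) :
    ∃ (c : ι → ℝ) (v : ι → κ → ℝ), IsPMF c ∧ (∀ i, IsPMF (v i)) ∧
      q = fun x => c x.2 * v x.2 x.1 := by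
  have hnn (i : ι) : 0 ≤ ∑ a, q (a, i) := Finset.sum_nonneg fun a _ => hq.1 _
  refine ⟨fun i => ∑ a, q (a, i),
    fun i => if ∑ a, q (a, i) = 0 then p else fun a => q (a, i) / ∑ b, q (b, i),
    ⟨hnn, ?_⟩, fun i => ?_, ?_⟩
  · rw [← hq.2, Fintype.sum_prod_type_right]
  · dsimp only
    split_ifs with h
    · exact hp
    · exact ⟨fun a => div_nonneg (hq.1 _) (hnn i), by rw [← Finset.sum_div, div_self h]⟩
  · funext ⟨a, i⟩
    dsimp only
    split_ifs with h
    · rw [h, zero_mul]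
      exact (Finset.sum_eq_zero_iff_of_nonneg fun a _ => hq.1 (a, i)).1 h a (Finset.mem_univ a)
    · rw [mul_div_cancel₀ _ h]

/-- The graph of `v ↦ (H(v), I(v))` over the simplex of joint pmfs. -/
def entropyGraph (α β : Type*) [Fintype α] [Fintype β] : Set ((α × β → ℝ) × ℝ × ℝ) :=
  (fun v => (v, Hent v, mi v)) '' stdSimplex ℝ (α × β)

theorem continuous_Hent {κ : Type*} [Fintype κ] : Continuous (Hent : (κ → ℝ) → ℝ) := by
  unfold Hent
  fun_prop

theorem continuous_pmfMap {κ δ : Type*} [Fintype κ] (f : κ → δ) :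
    Continuous (pmfMap f : (κ → ℝ) → δ → ℝ) := by
  refine continuous_pi fun d => continuous_finsetSum _ fun a _ => ?_
  split_ifs <;> fun_prop

theorem continuous_mi {α β : Type*} [Fintype α] [Fintype β] :
    Continuous (mi : (α × β → ℝ) → ℝ) :=
  ((continuous_Hent.comp (continuous_pmfMap _)).add
    (continuous_Hent.comp (continuous_pmfMap _))).sub continuous_Hent

theorem isCompact_convexHull_entropyGraph (α β : Type*) [Fintype α] [Fintype β] :
    IsCompact (convexHull ℝ (entropyGraph α β)) :=
  isCompact_convexHull_of_finiteDimensional <| (isCompact_stdSimplex ℝ _).image <|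
    continuous_id.prodMk (continuous_Hent.prodMk continuous_mi)

theorem sum_smul_entropyGraph {ι α β : Type*} [Fintype ι] [Fintype α] [Fintype β] (c : ι → ℝ)
    (v : ι → α × β → ℝ) :
    ∑ i, c i • (v i, Hent (v i), mi (v i)) =
      (∑ i, c i • v i, ∑ i, c i * Hent (v i), ∑ i, c i * mi (v i)) := by
  ext <;> simp [Prod.fst_sum, Prod.snd_sum]

/-- The pairs `(I(X,Y;W), I(X;Y|W))` attainable for a source `p`. -/
def attainableRegion {α β : Type*} [Fintype α] [Fintype β] (p : α × β → ℝ) : Set (ℝ × ℝ) :=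
  {z | (p, Hent p - z.1, z.2) ∈ convexHull ℝ (entropyGraph α β)}

theorem relaxedSet_eq {α β : Type*} [Fintype α] [Fintype β] {p : α × β → ℝ} (hp : IsPMF p)
    (γ : ℝ) : relaxedSet p γ = {t | ∃ z ∈ attainableRegion p, z.2 ≤ γ ∧ t = z.1} := by
  ext t
  constructor
  · rintro ⟨m, q, hq, hqp, hqγ, rfl⟩
    obtain ⟨c, v, hc, hv, rfl⟩ := exists_eq_mixture hp hq
    rw [pmfMap_fst_mixture] at hqp
    refine ⟨(miW _, cmi _), ?_, hqγ, rfl⟩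
    refine mem_convexHull_of_exists_fintype c (fun i => (v i, Hent (v i), mi (v i))) hc.1 hc.2
      (fun i => ⟨v i, hv i, rfl⟩) ?_
    rw [sum_smul_entropyGraph]
    dsimp only
    rw [miW_mixture c v fun i => (hv i).2,
      cmi_mixture c v fun i => (hv i).2, hqp, sub_sub_cancel]
  · rintro ⟨⟨t, s⟩, hz, hs, rfl⟩
    have hull : convexHull ℝ (entropyGraph α β) ⊆ {y | ∃ (m : ℕ) (c : Fin m → ℝ)
        (v : Fin m → α × β → ℝ), IsPMF c ∧ (∀ i, IsPMF (v i)) ∧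
        ∑ i, c i • (v i, Hent (v i), mi (v i)) = y} := by
      intro y hy
      obtain ⟨ι, _, c, z, hc, hc1, hz, rfl⟩ := mem_convexHull_iff_exists_fintype.1 hy
      choose v hv hvz using hz
      let e := (Fintype.equivFin ι).symm
      refine ⟨Fintype.card ι, c ∘ e, v ∘ e, ⟨fun i => hc _, ?_⟩, fun i => hv _, ?_⟩
      · rw [← hc1]; exact e.sum_comp c
      · rw [← e.sum_comp fun i => c i • z i]
        exact Finset.sum_congr rfl fun i _ => by rw [← hvz]; rfl
    obtain ⟨m, c, v, hc, hv, hy⟩ := hull hz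
    rw [sum_smul_entropyGraph, Prod.mk.injEq, Prod.mk.injEq] at hy
    obtain ⟨hy₁, hy₂, hy₃⟩ := hy
    refine ⟨m, fun x => c x.2 * v x.2 x.1,
      ⟨fun x => mul_nonneg (hc.1 _) ((hv _).1 _), ?_⟩, ?_, ?_, ?_⟩
    · simp [Fintype.sum_prod_type_right, ← Finset.mul_sum, (hv _).2, hc.2]
    · rw [pmfMap_fst_mixture, hy₁]
    · rwa [cmi_mixture c v fun i => (hv i).2, hy₃]
    · rw [miW_mixture c v fun i => (hv i).2, hy₁, hy₂, sub_sub_cancel]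

theorem isCompact_attainableRegion {α β : Type*} [Fintype α] [Fintype β] (p : α × β → ℝ) :
    IsCompact (attainableRegion p) := by
  have h := ((isCompact_convexHull_entropyGraph α β).inter_right
    (isClosed_eq continuous_fst (continuous_const (y := p)))).image
    (f := fun y => (Hent p - y.2.1, y.2.2)) (by fun_prop)
  convert h using 1
  ext ⟨t, s⟩
  constructor
  · intro hz
    exact ⟨_, ⟨hz, rfl⟩, by simp⟩
  · rintro ⟨⟨p', h', s'⟩, ⟨hy, rfl : p' = p⟩, heq⟩
    obtain ⟨rfl, rfl⟩ := Prod.mk.inj heq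
    simpa [attainableRegion] using hy

theorem convex_attainableRegion {α β : Type*} [Fintype α] [Fintype β] (p : α × β → ℝ) :
    Convex ℝ (attainableRegion p) := by
  intro z hz z' hz' a b ha hb hab
  have h := convex_convexHull ℝ (entropyGraph α β) hz hz' ha hb hab
  have heq : a • (p, Hent p - z.1, z.2) + b • (p, Hent p - z'.1, z'.2) =
      (p, Hent p - (a • z + b • z').1, (a • z + b • z').2) := by
    refine Prod.ext ?_ (Prod.ext ?_ rfl)
    · simp [← add_smul, hab]
    · simp only [Prod.snd_add, Prod.smul_snd, Prod.fst_add, Prod.smul_fst, smul_eq_mul]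
      linear_combination Hent p * hab
  rwa [heq] at h

theorem pmfMap_single {κ δ : Type*} [Fintype κ] [DecidableEq κ] [DecidableEq δ] (f : κ → δ)
    (a : κ) : pmfMap f (Pi.single a 1) = Pi.single (f a) 1 := by
  funext d
  rw [pmfMap, Finset.sum_eq_single a (fun b _ hb => by simp [hb]) (by simp)]
  simp [Pi.single_apply, eq_comm]

theorem Hent_single {κ : Type*} [Fintype κ] [DecidableEq κ] (a : κ) :
    Hent (Pi.single a 1 : κ → ℝ) = 0 :=
  Finset.sum_eq_zero fun b _ => by
    rw [Pi.single_apply]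
    split_ifs <;> simp

/-- The choice `W = (X, Y)` attains `I(X;Y|W) = 0`. -/
theorem entropy_zero_mem_attainableRegion {α β : Type*} [Fintype α] [Fintype β] {p : α × β → ℝ}
    (hp : IsPMF p) : (Hent p, 0) ∈ attainableRegion p := by
  refine mem_convexHull_of_exists_fintype p
    (fun a => ((Pi.single a 1 : α × β → ℝ), Hent (Pi.single a 1 : α × β → ℝ),
      mi (Pi.single a 1 : α × β → ℝ))) hp.1 hp.2
    (fun a => ⟨_, single_mem_stdSimplex ℝ a, rfl⟩) ?_
  rw [sum_smul_entropyGraph]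
  simp only [mi, pmfMap_single, Hent_single]
  refine Prod.ext ?_ (by simp)
  funext b
  simp [Pi.single_apply]

/-- For finite-alphabet `X, Y`, the map `γ ↦ C_γ(X;Y)` is convex on `[0,∞)`
and continuous on `[0,∞)`. -/
theorem relaxedWyner_convex_continuous
    {α β : Type*} [Fintype α] [Fintype β] (p : α × β → ℝ) (hp : IsPMF p) :
    ConvexOn ℝ (Set.Ici (0 : ℝ)) (fun γ => Cgamma p γ) ∧
      ContinuousOn (fun γ => Cgamma p γ) (Set.Ici (0 : ℝ)) := by
  simp only [Cgamma, relaxedSet_eq hp]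
  exact convexOn_continuousOn_sInf_of_isCompact (isCompact_attainableRegion p)
    (convex_attainableRegion p) ⟨_, entropy_zero_mem_attainableRegion hp, le_rfl⟩
end

section
/- If f and g are injective (one-to-one) functions on the alphabets of the finite-alphabet random variables X and Y respectively, then for every γ ≥ 0, the relaxed Wyner's common information is invariant: C_γ(f(X); g(Y)) = C_γ(X;Y). -/
open scoped BigOperators
open Classical

section Pushforward

variable {α β δ : Type*} [Fintype α]

theorem pmfMap_comp [Fintype β] (k : α → β) (h : β → δ) (p : α → ℝ) :
    pmfMap h (pmfMap k p) = pmfMap (h ∘ k) p := by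
  funext d
  simp only [pmfMap, Function.comp_apply, ← Finset.sum_filter (fun b => h b = d)]
  rw [Finset.sum_comm]
  simp

theorem pmfMap_apply_of_injective {i : α → β} (hi : Function.Injective i) (p : α → ℝ) (a : α) :
    pmfMap i p (i a) = p a := by
  simp [pmfMap, hi.eq_iff]

theorem pmfMap_apply_of_notMem_range {i : α → β} (p : α → ℝ) {b : β} (hb : b ∉ Set.range i) :
    pmfMap i p b = 0 :=
  Finset.sum_eq_zero fun a _ => if_neg fun h => hb ⟨a, h⟩

theorem pmfMap_injective {i : α → β} (hi : Function.Injective i) :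
    Function.Injective (pmfMap i) := by
  intro p q h
  funext a
  rw [← pmfMap_apply_of_injective hi p, h, pmfMap_apply_of_injective hi]

theorem pmfMap_comp_of_injective {i : α → β} (hi : Function.Injective i) {q : β → ℝ}
    (hq : ∀ b ∉ Set.range i, q b = 0) : pmfMap i (q ∘ i) = q := by
  funext b
  by_cases hb : b ∈ Set.range i
  · obtain ⟨a, rfl⟩ := hb
    exact pmfMap_apply_of_injective hi _ a
  · rw [pmfMap_apply_of_notMem_range _ hb, hq b hb]

theorem sum_pmfMap_s5 [Fintype β] (i : α → β) (p : α → ℝ) : ∑ b, pmfMap i p b = ∑ a, p a := by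
  simp only [pmfMap]
  rw [Finset.sum_comm]
  simp

theorem isPMF_pmfMap_iff [Fintype β] {i : α → β} (hi : Function.Injective i) (p : α → ℝ) :
    IsPMF (pmfMap i p) ↔ IsPMF p := by
  refine and_congr ⟨fun h a => pmfMap_apply_of_injective hi p a ▸ h (i a), fun h b => ?_⟩
    (by rw [sum_pmfMap_s5])
  exact Finset.sum_nonneg fun a _ => by split_ifs <;> simp [h a]

theorem Hent_pmfMap_of_injective [Fintype β] {i : α → β} (hi : Function.Injective i) (p : α → ℝ) :
    Hent (pmfMap i p) = Hent p := by
  refine (Fintype.sum_of_injective i hi _ _ (fun b hb => ?_) fun a => ?_).symm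
  · simp [pmfMap_apply_of_notMem_range p hb]
  · rw [pmfMap_apply_of_injective hi]

theorem apply_eq_zero_of_pmfMap_eq_zero {h : α → β} {q : α → ℝ} (hq : ∀ a, 0 ≤ q a) {a : α}
    (h0 : pmfMap h q (h a) = 0) : q a = 0 := by
  have hs := (Finset.sum_eq_zero_iff_of_nonneg
    (fun a' _ => by split_ifs <;> simp [hq a'])).1 h0 a (Finset.mem_univ a)
  simpa using hs

end Pushforward

section Relabeling

variable {α β α' β' W : Type*} [Fintype α] [Fintype β] [Fintype α'] [Fintype β'] [Fintype W]
  {f : α → α'} {g : β → β'}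

theorem miW_pmfMap (hf : Function.Injective f) (hg : Function.Injective g)
    (q : (α × β) × W → ℝ) :
    miW (pmfMap (Prod.map (Prod.map f g) id) q) = miW q := by
  have hfg : Function.Injective (Prod.map f g) := hf.prodMap hg
  have h1 : pmfMap Prod.fst (pmfMap (Prod.map (Prod.map f g) (id : W → W)) q)
      = pmfMap (Prod.map f g) (pmfMap Prod.fst q) := by
    rw [pmfMap_comp, pmfMap_comp]; rfl
  have h2 : pmfMap Prod.snd (pmfMap (Prod.map (Prod.map f g) (id : W → W)) q)
      = pmfMap Prod.snd q := by
    rw [pmfMap_comp]; rfl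
  rw [miW, h1, h2, Hent_pmfMap_of_injective hfg,
    Hent_pmfMap_of_injective (hfg.prodMap Function.injective_id), miW]

theorem cmi_pmfMap (hf : Function.Injective f) (hg : Function.Injective g)
    (q : (α × β) × W → ℝ) :
    cmi (pmfMap (Prod.map (Prod.map f g) id) q) = cmi q := by
  have h1 : pmfMap (fun x => (x.1.1, x.2)) (pmfMap (Prod.map (Prod.map f g) (id : W → W)) q)
      = pmfMap (Prod.map f id) (pmfMap (fun x => (x.1.1, x.2)) q) := by
    rw [pmfMap_comp, pmfMap_comp]; rfl
  have h2 : pmfMap (fun x => (x.1.2, x.2)) (pmfMap (Prod.map (Prod.map f g) (id : W → W)) q)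
      = pmfMap (Prod.map g id) (pmfMap (fun x => (x.1.2, x.2)) q) := by
    rw [pmfMap_comp, pmfMap_comp]; rfl
  have h3 : pmfMap Prod.snd (pmfMap (Prod.map (Prod.map f g) (id : W → W)) q)
      = pmfMap Prod.snd q := by
    rw [pmfMap_comp]; rfl
  rw [cmi, h1, h2, h3, Hent_pmfMap_of_injective (hf.prodMap Function.injective_id),
    Hent_pmfMap_of_injective (hg.prodMap Function.injective_id),
    Hent_pmfMap_of_injective ((hf.prodMap hg).prodMap Function.injective_id), cmi]

theorem relaxedSet_pmfMap (hf : Function.Injective f) (hg : Function.Injective g)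
    (p : α × β → ℝ) (γ : ℝ) :
    relaxedSet (pmfMap (Prod.map f g) p) γ = relaxedSet p γ := by
  have hfg : Function.Injective (Prod.map f g) := hf.prodMap hg
  have hG (m : ℕ) : Function.Injective (Prod.map (Prod.map f g) (id : Fin m → Fin m)) :=
    hfg.prodMap Function.injective_id
  have hfst {m : ℕ} (q : (α × β) × Fin m → ℝ) :
      pmfMap Prod.fst (pmfMap (Prod.map (Prod.map f g) id) q)
        = pmfMap (Prod.map f g) (pmfMap Prod.fst q) := by
    rw [pmfMap_comp, pmfMap_comp]; rfl
  ext c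
  constructor
  · rintro ⟨m, q', hq', hfst', hcmi, rfl⟩
    obtain ⟨q, rfl⟩ : ∃ q, pmfMap (Prod.map (Prod.map f g) id) q = q' := by
      refine ⟨_, pmfMap_comp_of_injective (hG m) fun b hb => ?_⟩
      refine apply_eq_zero_of_pmfMap_eq_zero (h := Prod.fst) hq'.1 ?_
      rw [hfst']
      refine pmfMap_apply_of_notMem_range p ?_
      rintro ⟨a, ha⟩
      exact hb ⟨(a, b.2), Prod.ext ha rfl⟩
    refine ⟨m, q, (isPMF_pmfMap_iff (hG m) q).1 hq', pmfMap_injective hfg ?_, ?_, ?_⟩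
    · rw [← hfst, hfst']
    · rwa [cmi_pmfMap hf hg] at hcmi
    · exact miW_pmfMap hf hg q
  · rintro ⟨m, q, hq, rfl, hcmi, rfl⟩
    exact ⟨m, pmfMap (Prod.map (Prod.map f g) id) q, (isPMF_pmfMap_iff (hG m) q).2 hq, hfst q,
      (cmi_pmfMap hf hg q).trans_le hcmi, (miW_pmfMap hf hg q).symm⟩

end Relabeling

/-- If `f` and `g` are injective maps on the alphabets of `X` and `Y`,
then for every `γ ≥ 0`, `C_γ(f(X); g(Y)) = C_γ(X;Y)`. -/
theorem relaxedWyner_injective_invariance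
    {α β α' β' : Type*} [Fintype α] [Fintype β] [Fintype α'] [Fintype β']
    (p : α × β → ℝ) (hp : IsPMF p)
    (f : α → α') (g : β → β') (hf : Function.Injective f) (hg : Function.Injective g)
    (γ : ℝ) (hγ : 0 ≤ γ) :
    Cgamma (pmfMap (Prod.map f g) p) γ = Cgamma p γ := by
  rw [Cgamma, relaxedSet_pmfMap hf hg, Cgamma]
end
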